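/- The function δ₁(τ) = (1/8)(θ₂(0,τ)⁴ + θ₃(0,τ)⁴) is a modular form of weight 2 over Γ₀(2) with trivial character: it is holomorphic on the upper half-plane ℍ, satisfies δ₁((aτ+b)/(cτ+d)) = (cτ+d)² δ₁(τ) for every matrix (a b; c d) ∈ Γ₀(2) and τ ∈ ℍ, and for every γ ∈ SL₂(ℤ) the weight-2 slash translate of δ₁ by γ is bounded as Im τ → ∞. -/

import Mathlib

open Complex

noncomputable section

/-- `q^s = e^{2πisτ}`. -/
def qpow (s τ : ℂ) : ℂ := Complex.exp (2 * (Real.pi : ℂ) * Complex.I * s * τ)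

/-- The Jacobi theta function `θ(v, τ)`, defined by its infinite product. -/
def jTheta (v τ : ℂ) : ℂ :=
  2 * qpow (1/8) τ * Complex.sin ((Real.pi : ℂ) * v) *
    ∏' j : ℕ, ((1 - qpow ((j : ℂ) + 1) τ)
      * (1 - Complex.exp (2 * (Real.pi : ℂ) * Complex.I * v) * qpow ((j : ℂ) + 1) τ)
      * (1 - Complex.exp (-(2 * (Real.pi : ℂ) * Complex.I * v)) * qpow ((j : ℂ) + 1) τ))

/-- The Jacobi theta function `θ₁(v, τ)`, defined by its infinite product. -/
def jTheta1 (v τ : ℂ) : ℂ :=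
  2 * qpow (1/8) τ * Complex.cos ((Real.pi : ℂ) * v) *
    ∏' j : ℕ, ((1 - qpow ((j : ℂ) + 1) τ)
      * (1 + Complex.exp (2 * (Real.pi : ℂ) * Complex.I * v) * qpow ((j : ℂ) + 1) τ)
      * (1 + Complex.exp (-(2 * (Real.pi : ℂ) * Complex.I * v)) * qpow ((j : ℂ) + 1) τ))

/-- The Jacobi theta function `θ₂(v, τ)`, defined by its infinite product
(the `j`-th factor involves `q^{j+1-1/2}`). -/
def jTheta2 (v τ : ℂ) : ℂ :=
  ∏' j : ℕ, ((1 - qpow ((j : ℂ) + 1) τ)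
    * (1 - Complex.exp (2 * (Real.pi : ℂ) * Complex.I * v) * qpow ((j : ℂ) + 1/2) τ)
    * (1 - Complex.exp (-(2 * (Real.pi : ℂ) * Complex.I * v)) * qpow ((j : ℂ) + 1/2) τ))

/-- The Jacobi theta function `θ₃(v, τ)`, defined by its infinite product. -/
def jTheta3 (v τ : ℂ) : ℂ :=
  ∏' j : ℕ, ((1 - qpow ((j : ℂ) + 1) τ)
    * (1 + Complex.exp (2 * (Real.pi : ℂ) * Complex.I * v) * qpow ((j : ℂ) + 1/2) τ)
    * (1 + Complex.exp (-(2 * (Real.pi : ℂ) * Complex.I * v)) * qpow ((j : ℂ) + 1/2) τ))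

/-- `θ'(0, τ)`: the partial derivative of `θ(v, τ)` in `v`, evaluated at `v = 0`. -/
def jThetaDeriv (τ : ℂ) : ℂ := deriv (fun v => jTheta v τ) 0

/-- `δ₁(τ) = (1/8)(θ₂(0,τ)⁴ + θ₃(0,τ)⁴)`. -/
def delta1 (τ : ℂ) : ℂ := (1/8) * (jTheta2 0 τ ^ 4 + jTheta3 0 τ ^ 4)

open ModularForm Filter Topology MatrixGroups
open UpperHalfPlane hiding I

/-- The product `∏ (1 - x ^ (2 j + 1))` over odd exponents converges in the unit disc. -/
lemma multipliable_one_sub_odd_pow {x : ℂ} (hx : ‖x‖ < 1) :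
    Multipliable fun n : ℕ ↦ 1 - x ^ (2 * n + 1) := by
  have h : Summable fun n : ℕ ↦ ‖-x ^ (2 * n + 1)‖ := by
    simpa [Function.comp_def] using (summable_geometric_of_lt_one (norm_nonneg x) hx).comp_injective
      (i := fun n : ℕ ↦ 2 * n + 1) (fun a b hab ↦ by simpa using hab)
  simpa [sub_eq_add_neg] using multipliable_one_add_of_summable h

lemma tprod_one_sub_pow_eq_odd_mul {x : ℂ} (hx : ‖x‖ < 1) :
    ∏' n : ℕ, (1 - x ^ (n + 1)) =
      (∏' n : ℕ, (1 - x ^ (2 * n + 1))) * ∏' n : ℕ, (1 - (x ^ 2) ^ (n + 1)) := by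
  have hx2 : ‖x ^ 2‖ < 1 := by simpa using pow_lt_one₀ (norm_nonneg x) hx two_ne_zero
  rw [← tprod_even_mul_odd (f := fun n : ℕ ↦ 1 - x ^ (n + 1))
    (multipliable_one_sub_odd_pow hx)
    ((multipliable_one_sub_pow hx2).congr fun n ↦ by ring)]
  congr 1
  exact tprod_congr fun n ↦ by ring

lemma norm_exp_pi_I_mul_lt_one {τ : ℂ} (hτ : 0 < τ.im) :
    ‖Complex.exp (Real.pi * I * τ)‖ < 1 := by
  rw [Complex.norm_exp, Real.exp_lt_one_iff]
  simpa using mul_pos Real.pi_pos hτ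

lemma jTheta2_zero_mul_tprod {τ : ℂ} (hτ : 0 < τ.im) :
    jTheta2 0 τ * ∏' n, (1 - eta_q n τ) = (∏' n, (1 - eta_q n (τ / 2))) ^ 2 := by
  set x := Complex.exp (Real.pi * I * τ) with hx
  have hx1 : ‖x‖ < 1 := norm_exp_pi_I_mul_lt_one hτ
  have hx2 : ‖x ^ 2‖ < 1 := by simpa using pow_lt_one₀ (norm_nonneg x) hx1 two_ne_zero
  have h1 (n : ℕ) : eta_q n τ = (x ^ 2) ^ (n + 1) := by
    rw [eta_q_eq_pow, hx, ← Complex.exp_nat_mul _ 2]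
    congr 2
    push_cast
    ring
  have h2 (n : ℕ) : eta_q n (τ / 2) = x ^ (n + 1) := by
    rw [eta_q_eq_pow, hx]
    congr 2
    ring
  have h3 (n : ℕ) : qpow ((n : ℂ) + 1) τ = (x ^ 2) ^ (n + 1) := by
    rw [← h1, eta_q_eq_cexp, qpow]
  have h4 (n : ℕ) : qpow ((n : ℂ) + 1 / 2) τ = x ^ (2 * n + 1) := by
    rw [qpow, hx, ← Complex.exp_nat_mul]
    congr 1
    push_cast
    ring
  have hm1 := multipliable_one_sub_pow hx2
  have hm2 := multipliable_one_sub_odd_pow hx1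
  simp only [jTheta2, h1, h2, h3, h4, mul_zero, neg_zero, Complex.exp_zero, one_mul]
  rw [(hm1.mul hm2).tprod_mul hm2, hm1.tprod_mul hm2, tprod_one_sub_pow_eq_odd_mul hx1]
  ring

lemma jTheta2_zero_eq_eta {τ : ℂ} (hτ : 0 < τ.im) :
    jTheta2 0 τ = η (τ / 2) ^ 2 / η τ := by
  rw [eq_div_iff (eta_ne_zero hτ), ModularForm.eta, ModularForm.eta, mul_pow,
    ← jTheta2_zero_mul_tprod hτ]
  have : Function.Periodic.qParam 24 (τ / 2) ^ 2 = Function.Periodic.qParam 24 τ := by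
    simp only [Function.Periodic.qParam, ← Complex.exp_nat_mul]
    congr 1
    push_cast
    ring
  rw [this]
  ring

lemma qpow_add_one (s τ : ℂ) : qpow s (τ + 1) = Complex.exp (2 * Real.pi * I * s) * qpow s τ := by
  rw [qpow, qpow, ← Complex.exp_add]
  ring_nf

lemma qpow_natCast_add_one_add_one (n : ℕ) (τ : ℂ) :
    qpow ((n : ℂ) + 1) (τ + 1) = qpow ((n : ℂ) + 1) τ := by
  rw [qpow_add_one, show 2 * (Real.pi : ℂ) * I * ((n : ℂ) + 1) =
    ((n + 1 : ℕ) : ℂ) * (2 * Real.pi * I) by push_cast; ring, Complex.exp_nat_mul_two_pi_mul_I,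
    one_mul]

lemma qpow_natCast_add_half_add_one (n : ℕ) (τ : ℂ) :
    qpow ((n : ℂ) + 1 / 2) (τ + 1) = -qpow ((n : ℂ) + 1 / 2) τ := by
  rw [qpow_add_one, show 2 * (Real.pi : ℂ) * I * ((n : ℂ) + 1 / 2) =
    (n : ℂ) * (2 * Real.pi * I) + Real.pi * I by ring, Complex.exp_add,
    Complex.exp_nat_mul_two_pi_mul_I, Complex.exp_pi_mul_I]
  ring

lemma jTheta2_add_one (v τ : ℂ) : jTheta2 v (τ + 1) = jTheta3 v τ := by
  simp only [jTheta2, jTheta3, qpow_natCast_add_one_add_one, qpow_natCast_add_half_add_one,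
    mul_neg, sub_neg_eq_add]

lemma jTheta3_add_one (v τ : ℂ) : jTheta3 v (τ + 1) = jTheta2 v τ := by
  simp only [jTheta2, jTheta3, qpow_natCast_add_one_add_one, qpow_natCast_add_half_add_one,
    mul_neg, ← sub_eq_add_neg]

/-- The η-quotient expressing `θ₁(0, τ) ^ 4`. -/
def theta1Fourth (τ : ℂ) : ℂ := 16 * η (2 * τ) ^ 8 / η τ ^ 4

lemma eta_add_one (τ : ℂ) : η (τ + 1) = Complex.exp (Real.pi * I / 12) * η τ := by
  have h1 : Function.Periodic.qParam 24 (τ + 1) =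
      Complex.exp (Real.pi * I / 12) * Function.Periodic.qParam 24 τ := by
    simp only [Function.Periodic.qParam, ← Complex.exp_add]
    congr 1
    push_cast
    ring
  have h2 (n : ℕ) : eta_q n (τ + 1) = eta_q n τ := by
    simpa [eta_q_eq_cexp, qpow] using qpow_natCast_add_one_add_one n τ
  simp only [ModularForm.eta, h1, h2]
  ring

lemma theta1Fourth_add_one (τ : ℂ) : theta1Fourth (τ + 1) = -theta1Fourth τ := by
  set w := Complex.exp (Real.pi * I / 12) with hw
  have hw0 : w ≠ 0 := Complex.exp_ne_zero _
  have hw12 : w ^ 12 = -1 := by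
    rw [hw, ← Complex.exp_nat_mul, ← Complex.exp_pi_mul_I]
    congr 1
    push_cast
    ring
  rw [theta1Fourth, theta1Fourth, show 2 * (τ + 1) = 2 * τ + 1 + 1 by ring]
  simp only [eta_add_one, ← hw]
  rw [show 16 * (w * (w * η (2 * τ))) ^ 8 = w ^ 4 * (w ^ 12 * (16 * η (2 * τ) ^ 8)) by ring,
    mul_pow, mul_div_mul_left _ _ (pow_ne_zero 4 hw0), hw12]
  ring

lemma eta_neg_inv_pow_four {τ : ℂ} (hτ : 0 < τ.im) :
    η (-1 / τ) ^ 4 = -τ ^ 2 * η τ ^ 4 := by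
  have hs (z : ℂ) : Complex.sqrt z ^ 4 = z ^ 2 := by
    rw [Complex.sqrt, ← Complex.cpow_nat_mul, ← Complex.cpow_ofNat]
    norm_num
  have h : η (-1 / τ) = (Complex.sqrt I)⁻¹ * (Complex.sqrt τ * η τ) := by
    simpa using eta_comp_eq_csqrt_I_inv hτ
  rw [h, mul_pow, mul_pow, inv_pow, hs I, hs τ, I_sq]
  ring

lemma neg_one_div_im_pos {τ : ℂ} (hτ : 0 < τ.im) : 0 < (-1 / τ).im := by
  simpa [neg_div] using (⟨τ, hτ⟩ : ℍ).im_inv_neg_coe_pos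

lemma jTheta2_zero_pow_four_neg_inv {τ : ℂ} (hτ : 0 < τ.im) :
    jTheta2 0 (-1 / τ) ^ 4 = -τ ^ 2 * theta1Fourth τ := by
  have hτ0 : τ ≠ 0 := by rintro rfl; simp at hτ
  have h2 : 0 < (2 * τ).im := by simpa using hτ
  have hη := eta_ne_zero hτ
  rw [jTheta2_zero_eq_eta (neg_one_div_im_pos hτ), div_pow,
    show -1 / τ / 2 = -1 / (2 * τ) by field_simp, eta_neg_inv_pow_four hτ, theta1Fourth,
    show (η (-1 / (2 * τ)) ^ 2) ^ 4 = (η (-1 / (2 * τ)) ^ 4) ^ 2 by ring,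
    eta_neg_inv_pow_four h2]
  field_simp
  ring

lemma theta1Fourth_neg_inv {τ : ℂ} (hτ : 0 < τ.im) :
    theta1Fourth (-1 / τ) = -τ ^ 2 * jTheta2 0 τ ^ 4 := by
  have hτ0 : τ ≠ 0 := by rintro rfl; simp at hτ
  have h := jTheta2_zero_pow_four_neg_inv (neg_one_div_im_pos hτ)
  rw [show -1 / (-1 / τ) = τ by field_simp] at h
  rw [h]
  field_simp

lemma jTheta3_zero_pow_four_neg_inv {τ : ℂ} (hτ : 0 < τ.im) :
    jTheta3 0 (-1 / τ) ^ 4 = -τ ^ 2 * jTheta3 0 τ ^ 4 := by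
  have hτ0 : τ ≠ 0 := by rintro rfl; simp at hτ
  have h1 : 0 < (τ + 1).im := by simpa using hτ
  have hτ1 : τ + 1 ≠ 0 := fun h ↦ by simp [h] at h1
  have hσ : 0 < (-1 / (τ + 1) + 1).im := by simpa using neg_one_div_im_pos h1
  have e1 : -1 / τ = -1 / (-1 / (τ + 1) + 1) + 1 := by
    have : -1 / (τ + 1) + 1 = τ / (τ + 1) := by field_simp; ring
    rw [this]
    field_simp
    ring
  rw [e1, jTheta3_add_one, jTheta2_zero_pow_four_neg_inv hσ, theta1Fourth_add_one,
    theta1Fourth_neg_inv h1, jTheta2_add_one]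
  field_simp
  ring

/-- The weight two translates of `δ₁` under `SL(2, ℤ)`, indexed by the bottom row of the matrix
(with value zero if both entries are even, which does not occur for unimodular matrices). -/
def delta1Translate (c d : ℤ) (τ : ℍ) : ℂ :=
  if Even c then
    if Even d then 0 else 1 / 8 * (jTheta2 0 τ ^ 4 + jTheta3 0 τ ^ 4)
  else
    if Even d then -(1 / 8) * (theta1Fourth τ + jTheta3 0 τ ^ 4)
    else 1 / 8 * (theta1Fourth τ - jTheta2 0 τ ^ 4)

lemma delta1Translate_slash_S (c d : ℤ) :
    delta1Translate c d ∣[(2 : ℤ)] ModularGroup.S = delta1Translate d (-c) := by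
  ext τ
  have h0 : (τ : ℂ) ≠ 0 := τ.ne_zero
  have h2 := jTheta2_zero_pow_four_neg_inv τ.im_pos
  have h3 := jTheta3_zero_pow_four_neg_inv τ.im_pos
  have h1 := theta1Fourth_neg_inv τ.im_pos
  rw [neg_div, one_div, ← inv_neg] at h1 h2 h3
  rw [ModularForm.SL_slash_apply, modular_S_smul, ModularGroup.denom_S]
  simp only [delta1Translate, even_neg, h1, h2, h3]
  by_cases hc : Even c <;> by_cases hd : Even d <;>
    simp only [hc, hd, if_true, if_false, zero_mul] <;> field_simp <;> ring

lemma delta1Translate_slash_T (c d : ℤ) :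
    delta1Translate c d ∣[(2 : ℤ)] ModularGroup.T = delta1Translate c (c + d) := by
  ext τ
  have hd : denom ModularGroup.T τ = 1 := by
    simp [ModularGroup.denom_apply, ModularGroup.coe_T]
  rw [ModularForm.SL_slash_apply, modular_T_smul, hd]
  simp only [delta1Translate, coe_vadd, ofReal_one, add_comm (1 : ℂ), jTheta2_add_one,
    jTheta3_add_one, theta1Fourth_add_one, Int.even_add]
  by_cases hc : Even c <;> by_cases hd : Even d <;> simp [hc, hd] <;> ring

lemma delta1_slash (γ : SL(2, ℤ)) :
    (fun τ : ℍ ↦ delta1 τ) ∣[(2 : ℤ)] γ = delta1Translate (γ 1 0) (γ 1 1) := by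
  have hγ : γ ∈ Subgroup.closure {ModularGroup.S, ModularGroup.T} := by
    simp [SpecialLinearGroup.SL2Z_generators]
  induction hγ using Subgroup.closure_induction_right with
  | one =>
    rw [SlashAction.slash_one]
    ext τ
    simp [delta1Translate, delta1]
  | mul_right x _ y hy ih =>
    rw [SlashAction.slash_mul, ih]
    rcases hy with rfl | rfl
    · rw [delta1Translate_slash_S]
      congr 1 <;> simp [ModularGroup.coe_S, Matrix.mul_apply, Fin.sum_univ_two]
    · rw [delta1Translate_slash_T]
      congr 1 <;> simp [ModularGroup.coe_T, Matrix.mul_apply, Fin.sum_univ_two]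
  | mul_inv_cancel x _ y hy ih =>
    rw [SlashAction.slash_mul, ih]
    rcases hy with rfl | rfl
    · have h : delta1Translate (x 1 0) (x 1 1) =
          delta1Translate (-x 1 1) (x 1 0) ∣[(2 : ℤ)] ModularGroup.S := by
        rw [delta1Translate_slash_S, neg_neg]
      rw [h, ← SlashAction.slash_mul, mul_inv_cancel, SlashAction.slash_one]
      congr 1 <;> simp [ModularGroup.coe_S, Matrix.mul_apply, Fin.sum_univ_two,
        Matrix.adjugate_fin_two]
    · have h : delta1Translate (x 1 0) (x 1 1) =
          delta1Translate (x 1 0) (x 1 1 - x 1 0) ∣[(2 : ℤ)] ModularGroup.T := by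
        rw [delta1Translate_slash_T, add_sub_cancel]
      rw [h, ← SlashAction.slash_mul, mul_inv_cancel, SlashAction.slash_one]
      congr 1 <;> simp [ModularGroup.coe_T, Matrix.mul_apply, Fin.sum_univ_two,
        Matrix.adjugate_fin_two]
      ring

lemma delta1_moebius (γ : SL(2, ℤ)) {τ : ℂ} (hτ : 0 < τ.im) :
    ((γ 1 0 : ℂ) * τ + (γ 1 1 : ℂ)) ≠ 0 ∧
    (((γ 1 0 : ℂ) * τ + (γ 1 1 : ℂ)) ^ 2)⁻¹ *
      delta1 (((γ 0 0 : ℂ) * τ + (γ 0 1 : ℂ)) / ((γ 1 0 : ℂ) * τ + (γ 1 1 : ℂ))) =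
        delta1Translate (γ 1 0) (γ 1 1) ⟨τ, hτ⟩ := by
  have hd : denom (γ : GL (Fin 2) ℝ) (⟨τ, hτ⟩ : ℍ) = (γ 1 0 : ℂ) * τ + (γ 1 1 : ℂ) := by
    simp [denom]
  refine ⟨hd ▸ denom_ne_zero _ _, ?_⟩
  have h := congrFun (delta1_slash γ) ⟨τ, hτ⟩
  rw [ModularForm.SL_slash_apply, hd] at h
  rw [← h, coe_specialLinearGroup_apply, zpow_neg, zpow_ofNat, mul_comm]
  simp

lemma tendsto_eta_tprod :
    Tendsto (fun τ : ℂ ↦ ∏' n, (1 - eta_q n τ)) (comap Complex.im atTop) (𝓝 1) := by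
  have h0 : (0 : ℂ) ∈ Metric.ball (0 : ℂ) 1 := Metric.mem_ball_self one_pos
  have h1 : Tendsto (fun q : ℂ ↦ ∏' n : ℕ, (1 - q ^ (n + 1))) (𝓝 0) (𝓝 1) := by
    simpa using (differentiableOn_tprod_one_sub_pow.continuousOn.continuousAt
      (Metric.isOpen_ball.mem_nhds h0)).tendsto
  exact h1.comp ((Function.Periodic.qParam_tendsto one_pos).mono_right nhdsWithin_le_nhds)

lemma tendsto_jTheta2_zero :
    Tendsto (jTheta2 0) (comap Complex.im atTop) (𝓝 1) := by
  have h2 : Tendsto (fun τ : ℂ ↦ τ / 2) (comap Complex.im atTop) (comap Complex.im atTop) := by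
    rw [tendsto_comap_iff]
    have : Complex.im ∘ (fun τ : ℂ ↦ τ / 2) = fun τ ↦ τ.im / 2 := by ext; simp
    rw [this]
    exact tendsto_comap.atTop_div_const two_pos
  have h := ((tendsto_eta_tprod.comp h2).pow 2).div tendsto_eta_tprod one_ne_zero
  rw [one_pow, div_one] at h
  refine h.congr' ?_
  filter_upwards [tendsto_comap.eventually (eventually_gt_atTop 0)] with τ hτ
  simp only [Pi.div_apply, Function.comp_apply]
  rw [div_eq_iff (eta_tprod_ne_zero hτ), jTheta2_zero_mul_tprod hτ]

lemma tendsto_jTheta3_zero :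
    Tendsto (jTheta3 0) (comap Complex.im atTop) (𝓝 1) := by
  have h1 : Tendsto (fun τ : ℂ ↦ τ + 1) (comap Complex.im atTop) (comap Complex.im atTop) := by
    rw [tendsto_comap_iff]
    exact tendsto_comap.congr fun τ ↦ by simp
  exact (tendsto_jTheta2_zero.comp h1).congr fun τ ↦ jTheta2_add_one 0 τ

lemma tendsto_theta1Fourth :
    Tendsto theta1Fourth (comap Complex.im atTop) (𝓝 0) := by
  have h2 : Tendsto (fun τ : ℂ ↦ 2 * τ) (comap Complex.im atTop) (comap Complex.im atTop) := by
    rw [tendsto_comap_iff]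
    have : Complex.im ∘ (fun τ : ℂ ↦ 2 * τ) = fun τ ↦ 2 * τ.im := by ext; simp
    rw [this]
    exact tendsto_comap.const_mul_atTop two_pos
  have hq : Tendsto (fun τ : ℂ ↦ Function.Periodic.qParam 2 τ) (comap Complex.im atTop) (𝓝 0) :=
    (Function.Periodic.qParam_tendsto two_pos).mono_right nhdsWithin_le_nhds
  have h := (hq.const_mul 16).mul
    (((tendsto_eta_tprod.comp h2).pow 8).div (tendsto_eta_tprod.pow 4) (by simp))
  rw [mul_zero, zero_mul] at h
  refine h.congr fun τ ↦ ?_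
  have e : Function.Periodic.qParam 24 (2 * τ) ^ 8 =
      Function.Periodic.qParam 2 τ * Function.Periodic.qParam 24 τ ^ 4 := by
    simp only [Function.Periodic.qParam, ← Complex.exp_nat_mul, ← Complex.exp_add]
    congr 1
    push_cast
    ring
  have hq0 := Function.Periodic.qParam_ne_zero (h := 24) τ
  simp only [theta1Fourth, ModularForm.eta, mul_pow, e, Pi.div_apply,
    Function.comp_apply]
  field_simp

lemma norm_delta1Translate_bounded (c d : ℤ) :
    ∃ C A : ℝ, ∀ τ : ℍ, A ≤ τ.im → ‖delta1Translate c d τ‖ ≤ C := by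
  have h2 := tendsto_jTheta2_zero.pow 4
  have h3 := tendsto_jTheta3_zero.pow 4
  have h1 := tendsto_theta1Fourth
  have h : ∃ l, Tendsto (fun τ : ℍ ↦ delta1Translate c d τ) atImInfty (𝓝 l) := by
    have hc : Tendsto ((↑) : ℍ → ℂ) atImInfty (comap Complex.im atTop) :=
      tendsto_comap_iff.mpr tendsto_comap
    unfold delta1Translate
    split_ifs
    · exact ⟨_, tendsto_const_nhds⟩
    · exact ⟨_, ((h2.add h3).const_mul _).comp hc⟩
    · exact ⟨_, ((h1.add h3).const_mul _).comp hc⟩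
    · exact ⟨_, ((h1.sub h2).const_mul _).comp hc⟩
  obtain ⟨l, hl⟩ := h
  obtain ⟨A, hA⟩ := (atImInfty_mem _).mp
    (hl.norm.eventually (eventually_le_nhds (lt_add_one ‖l‖)))
  exact ⟨_, A, hA⟩

lemma differentiableOn_jTheta2_zero : DifferentiableOn ℂ (jTheta2 0) {τ | 0 < τ.im} := by
  refine DifferentiableOn.congr (f := fun τ ↦ η (τ / 2) ^ 2 / η τ) (fun τ hτ ↦ ?_)
    fun τ hτ ↦ jTheta2_zero_eq_eta hτ
  have hτ2 : 0 < (τ / 2).im := by simpa using hτ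
  have h := DifferentiableAt.comp τ (differentiableAt_eta_of_mem_upperHalfPlaneSet hτ2)
    (f := fun τ : ℂ ↦ τ / 2) (by fun_prop)
  exact ((h.pow 2).div (differentiableAt_eta_of_mem_upperHalfPlaneSet hτ)
    (eta_ne_zero hτ)).differentiableWithinAt

lemma differentiableOn_jTheta3_zero : DifferentiableOn ℂ (jTheta3 0) {τ | 0 < τ.im} := by
  refine (differentiableOn_jTheta2_zero.comp (f := fun τ : ℂ ↦ τ + 1) (by fun_prop)
    fun τ hτ ↦ ?_).congr fun τ _ ↦ (jTheta2_add_one 0 τ).symm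
  simpa using hτ

/-- `δ₁` is a modular form of weight 2 over `Γ₀(2)` with trivial character:
it is holomorphic on the upper half-plane, transforms with weight 2 under `Γ₀(2)`,
and all its weight-2 slash translates are bounded as `Im τ → ∞`. -/
theorem delta1_modularForm_weight_two_Gamma0_two :
    DifferentiableOn ℂ delta1 {τ : ℂ | 0 < τ.im} ∧
    (∀ γ : Matrix.SpecialLinearGroup (Fin 2) ℤ, γ ∈ CongruenceSubgroup.Gamma0 2 →
      ∀ τ : ℂ, 0 < τ.im →
        delta1 (((γ 0 0 : ℂ) * τ + (γ 0 1 : ℂ)) / ((γ 1 0 : ℂ) * τ + (γ 1 1 : ℂ))) =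
          ((γ 1 0 : ℂ) * τ + (γ 1 1 : ℂ)) ^ 2 * delta1 τ) ∧
    (∀ γ : Matrix.SpecialLinearGroup (Fin 2) ℤ, ∃ C A : ℝ, ∀ τ : ℂ, A ≤ τ.im →
      ‖(((γ 1 0 : ℂ) * τ + (γ 1 1 : ℂ)) ^ 2)⁻¹ *
        delta1 (((γ 0 0 : ℂ) * τ + (γ 0 1 : ℂ)) / ((γ 1 0 : ℂ) * τ + (γ 1 1 : ℂ)))‖ ≤ C) := by
  refine ⟨?_, fun γ hγ τ hτ ↦ ?_, fun γ ↦ ?_⟩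
  · exact ((differentiableOn_jTheta2_zero.pow 4).add
      (differentiableOn_jTheta3_zero.pow 4)).const_mul (1 / 8)
  · obtain ⟨h0, h⟩ := delta1_moebius γ hτ
    rw [← mul_inv_cancel_left₀ (pow_ne_zero 2 h0) (delta1 (_ / _)), h]
    have hc : Even (γ 1 0) := by
      rw [CongruenceSubgroup.Gamma0_mem] at hγ
      exact even_iff_two_dvd.mpr ((ZMod.intCast_zmod_eq_zero_iff_dvd _ 2).mp hγ)
    have hd : ¬ Even (γ 1 1) := fun hd ↦ by
      have hdet := γ.det_coe
      rw [Matrix.det_fin_two] at hdet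
      have : Even (1 : ℤ) := hdet ▸ (hd.mul_left _).sub (hc.mul_left _)
      simp at this
    simp [delta1Translate, hc, hd, delta1]
  · obtain ⟨C, A, h⟩ := norm_delta1Translate_bounded (γ 1 0) (γ 1 1)
    refine ⟨C, max A 1, fun τ hτ ↦ ?_⟩
    have hτ0 : 0 < τ.im := one_pos.trans_le ((le_max_right A 1).trans hτ)
    rw [(delta1_moebius γ hτ0).2]
    exact h _ ((le_max_left A 1).trans hτ)
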